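/- For multivariate Gaussians N(μ₁, Σ₁) and N(μ₂, Σ₂) on ℝⁿ with commuting positive semidefinite covariance matrices Σ₁Σ₂ = Σ₂Σ₁, the squared 2-Wasserstein distance equals ‖μ₁ − μ₂‖₂² + ‖Σ₁^{1/2} − Σ₂^{1/2}‖_F², where ‖·‖_F is the Frobenius norm. -/

import Mathlib

open MeasureTheory ProbabilityTheory NNReal ENNReal

/-- The standard Gaussian measure on `EuclideanSpace ℝ (Fin n)`. -/
noncomputable def stdGaussianE (n : ℕ) : Measure (EuclideanSpace ℝ (Fin n)) :=
  (Measure.pi fun _ : Fin n => gaussianReal 0 1).map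
    (EuclideanSpace.equiv (Fin n) ℝ).symm

/-- The multivariate Gaussian `N(μ, A·Aᵀ)` on `EuclideanSpace ℝ (Fin n)`, realized as
the pushforward of the standard Gaussian under `x ↦ μ + A x`, where `A` is a
(positive semidefinite) square root of the covariance matrix. -/
noncomputable def gaussianE {n : ℕ} (μ : EuclideanSpace ℝ (Fin n))
    (A : Matrix (Fin n) (Fin n) ℝ) : Measure (EuclideanSpace ℝ (Fin n)) :=
  (stdGaussianE n).map (fun x => μ + Matrix.toEuclideanLin A x)

/-- Squared 2-Wasserstein distance between measures on `EuclideanSpace ℝ (Fin n)`. -/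
noncomputable def W2sqE {n : ℕ} (P Q : Measure (EuclideanSpace ℝ (Fin n))) : ℝ≥0∞ :=
  ⨅ (γ : Measure (EuclideanSpace ℝ (Fin n) × EuclideanSpace ℝ (Fin n)))
    (_ : γ.map Prod.fst = P) (_ : γ.map Prod.snd = Q),
    ∫⁻ p, ENNReal.ofReal (‖p.1 - p.2‖ ^ 2) ∂γ

open scoped RealInnerProductSpace

section Moments

variable {Ω : Type*} [MeasurableSpace Ω] {P : Measure Ω} {X Y : Ω → ℝ}

/-- The Cauchy–Schwarz inequality for the covariance. -/
lemma covariance_sq_le_variance_mul_variance [IsFiniteMeasure P]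
    (hX : MemLp X 2 P) (hY : MemLp Y 2 P) :
    cov[X, Y; P] ^ 2 ≤ Var[X; P] * Var[Y; P] := by
  have key (t : ℝ) : 0 ≤ Var[X; P] * (t * t) + (-2 * cov[X, Y; P]) * t + Var[Y; P] := by
    have h := variance_nonneg ((t • X) - Y) P
    rw [variance_sub (hX.const_smul t) hY, variance_smul, covariance_smul_left] at h
    linarith
  have := discrim_le_zero key
  rw [discrim] at this
  nlinarith

/-- The squared `L²` distance of two random variables with standard deviations `a` and `b` is at
least the squared distance of their means plus `(a - b) ^ 2`. -/
lemma sq_sub_add_sq_sub_le_integral_sq_sub [IsProbabilityMeasure P]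
    (hX : MemLp X 2 P) (hY : MemLp Y 2 P) {a b : ℝ} (ha : 0 ≤ a) (hb : 0 ≤ b)
    (hXa : Var[X; P] = a ^ 2) (hYb : Var[Y; P] = b ^ 2) :
    (P[X] - P[Y]) ^ 2 + (a - b) ^ 2 ≤ ∫ ω, (X ω - Y ω) ^ 2 ∂P := by
  have hcov : cov[X, Y; P] ≤ a * b := by
    refine le_of_abs_le (abs_le_of_sq_le_sq ?_ (mul_nonneg ha hb))
    calc _ ≤ _ := covariance_sq_le_variance_mul_variance hX hY
      _ = _ := by rw [hXa, hYb]; ring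
  have h₁ := variance_eq_sub (hX.sub hY)
  have h₂ : P[X - Y] = P[X] - P[Y] :=
    integral_sub (hX.integrable one_le_two) (hY.integrable one_le_two)
  rw [variance_sub hX hY, h₂, hXa, hYb] at h₁
  simp only [Pi.pow_apply, Pi.sub_apply] at h₁
  nlinarith

end Moments

section Diagonalization

variable {E : Type*} [NormedAddCommGroup E] [InnerProductSpace ℝ E]

/-- Commuting symmetric operators have a common orthonormal eigenbasis. -/
lemma LinearMap.IsSymmetric.exists_orthonormalBasis_of_commute [FiniteDimensional ℝ E]
    {S T : E →ₗ[ℝ] E} (hS : S.IsSymmetric) (hT : T.IsSymmetric) (hST : Commute S T)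
    {n : ℕ} (hn : Module.finrank ℝ E = n) :
    ∃ (e : OrthonormalBasis (Fin n) ℝ E) (a b : Fin n → ℝ),
      ∀ i, S (e i) = a i • e i ∧ T (e i) = b i • e i := by
  classical
  let V : ℝ × ℝ → Submodule ℝ E := fun i =>
    Module.End.eigenspace S i.2 ⊓ Module.End.eigenspace T i.1
  have hV : OrthogonalFamily ℝ (fun i => V i) fun i => (V i).subtypeₗᵢ :=
    hS.orthogonalFamily_eigenspace_inf_eigenspace hT
  have hInt : DirectSum.IsInternal V := hS.directSum_isInternal_of_commute hT hST
  have : Finite {i // V i ≠ ⊥} :=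
    WellFoundedGT.finite_ne_bot_of_iSupIndep hInt.submodule_iSupIndep
  have := Fintype.ofFinite {i // V i ≠ ⊥}
  have hInt' := DirectSum.isInternal_ne_bot_iff.2 hInt
  have hV' : OrthogonalFamily ℝ (fun i : {i // V i ≠ ⊥} => V i) fun i => (V i).subtypeₗᵢ :=
    hV.comp Subtype.val_injective
  let k := fun i => (hInt'.subordinateOrthonormalBasisIndex hn i hV').1
  refine ⟨hInt'.subordinateOrthonormalBasis hn hV', fun i => (k i).2, fun i => (k i).1,
    fun i => ?_⟩
  have h := hInt'.subordinateOrthonormalBasis_subordinate hn i hV'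
  exact ⟨Module.End.mem_eigenspace_iff.1 h.1, Module.End.mem_eigenspace_iff.1 h.2⟩

/-- An eigenvector of the square of a positive operator is an eigenvector of the operator. -/
lemma LinearMap.IsPositive.exists_apply_eq_smul {T : E →ₗ[ℝ] E} (hT : T.IsPositive)
    {v : E} {c : ℝ} (hv : T (T v) = c • v) : ∃ a : ℝ, 0 ≤ a ∧ T v = a • v := by
  by_cases hv0 : v = 0
  · exact ⟨0, le_rfl, by simp [hv0]⟩
  have hTv : ⟪T v, T v⟫ = c * ⟪v, v⟫ := by
    rw [← hT.isSymmetric (T v) v, hv, real_inner_smul_left]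
  have hc : 0 ≤ c := by
    have : 0 < ⟪v, v⟫ := real_inner_self_pos.2 hv0
    have : 0 ≤ ⟪T v, T v⟫ := real_inner_self_nonneg
    by_contra! h
    nlinarith
  refine ⟨√c, Real.sqrt_nonneg c, ?_⟩
  obtain rfl | hc := hc.eq_or_lt
  · rw [zero_mul, inner_self_eq_zero] at hTv
    simp [hTv]
  have hw : T (T v - √c • v) = -√c • (T v - √c • v) := by
    rw [map_sub, map_smul, hv, smul_sub, smul_smul, neg_mul, Real.mul_self_sqrt hc.le]
    module
  have hpos : 0 ≤ ⟪T (T v - √c • v), T v - √c • v⟫ := hT.2 _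
  rw [hw, real_inner_smul_left] at hpos
  have : ⟪T v - √c • v, T v - √c • v⟫ ≤ 0 := by
    have := Real.sqrt_pos.2 hc
    by_contra! h
    nlinarith
  exact sub_eq_zero.1 (inner_self_eq_zero.1 (this.antisymm real_inner_self_nonneg))

end Diagonalization

section Matrix

variable {n : ℕ}

/-- The squared Frobenius norm in terms of an orthonormal eigenbasis. -/
lemma sum_sq_entries_eq_sum_sq_eigenvalues {ι : Type*} [Fintype ι]
    {A : Matrix (Fin n) (Fin n) ℝ} (hA : A.IsHermitian)
    (e : OrthonormalBasis ι ℝ (EuclideanSpace ℝ (Fin n))) {a : ι → ℝ}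
    (he : ∀ i, Matrix.toEuclideanLin A (e i) = a i • e i) :
    ∑ i, ∑ j, A i j ^ 2 = ∑ k, a k ^ 2 := by
  have hsymm := Matrix.isSymmetric_toEuclideanLin_iff.2 hA
  have hrow (i j : Fin n) : ⟪EuclideanSpace.single i 1,
      Matrix.toEuclideanLin A (EuclideanSpace.single j 1)⟫ = A i j := by
    simp [EuclideanSpace.inner_single_left, Matrix.toLpLin_apply]
  have h₁ (j : Fin n) : ∑ i, A i j ^ 2 =
      ∑ k, (a k * ⟪e k, EuclideanSpace.single j 1⟫) ^ 2 := by
    set w := Matrix.toEuclideanLin A (EuclideanSpace.single j 1) with hw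
    have h₂ := (EuclideanSpace.basisFun (Fin n) ℝ).sum_sq_inner_right w
    have h₃ := e.sum_sq_inner_right w
    rw [← h₂] at h₃
    simp only [EuclideanSpace.basisFun_apply, hw, hrow] at h₃
    rw [← h₃]
    refine Finset.sum_congr rfl fun k _ => ?_
    rw [← hsymm, he, real_inner_smul_left]
  rw [Finset.sum_comm]
  simp_rw [h₁, mul_pow]
  rw [Finset.sum_comm]
  refine Finset.sum_congr rfl fun k _ => ?_
  have := (EuclideanSpace.basisFun (Fin n) ℝ).sum_sq_inner_left (e k)
  simp only [EuclideanSpace.basisFun_apply] at this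
  rw [← Finset.mul_sum, this, e.norm_eq_one, one_pow, mul_one]

/-- Positive semidefinite square roots of commuting matrices have a common orthonormal
eigenbasis. -/
lemma Matrix.PosSemidef.exists_common_orthonormalBasis {A B : Matrix (Fin n) (Fin n) ℝ}
    (hA : A.PosSemidef) (hB : B.PosSemidef) (hcomm : Commute (A * A) (B * B)) :
    ∃ (e : OrthonormalBasis (Fin n) ℝ (EuclideanSpace ℝ (Fin n))) (a b : Fin n → ℝ), ∀ i,
      (0 ≤ a i ∧ Matrix.toEuclideanLin A (e i) = a i • e i) ∧
      (0 ≤ b i ∧ Matrix.toEuclideanLin B (e i) = b i • e i) := by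
  have hmul (C D : Matrix (Fin n) (Fin n) ℝ) : Matrix.toEuclideanLin (C * D) =
      Matrix.toEuclideanLin C * Matrix.toEuclideanLin D := by
    ext x : 1
    simp [Matrix.toLpLin_apply, Matrix.mulVec_mulVec]
  have hsymm {C : Matrix (Fin n) (Fin n) ℝ} (hC : C.PosSemidef) :
      (Matrix.toEuclideanLin (C * C)).IsSymmetric :=
    Matrix.isSymmetric_toEuclideanLin_iff.2 <| by
      rw [Matrix.IsHermitian, Matrix.conjTranspose_mul, hC.isHermitian.eq]
  have hpos {C : Matrix (Fin n) (Fin n) ℝ} (hC : C.PosSemidef) :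
      (Matrix.toEuclideanLin C).IsPositive := Matrix.isPositive_toEuclideanLin_iff.2 hC
  obtain ⟨e, c, d, he⟩ := (hsymm hA).exists_orthonormalBasis_of_commute (hsymm hB)
    (by rw [Commute, SemiconjBy, ← hmul, ← hmul, hcomm.eq]) finrank_euclideanSpace_fin
  simp only [hmul] at he
  choose a ha using fun i => (hpos hA).exists_apply_eq_smul (he i).1
  choose b hb using fun i => (hpos hB).exists_apply_eq_smul (he i).2
  exact ⟨e, a, b, fun i => ⟨ha i, hb i⟩⟩

end Matrix

section Gaussian

variable {n : ℕ}

lemma stdGaussianE_eq_stdGaussian : stdGaussianE n = stdGaussian (EuclideanSpace ℝ (Fin n)) :=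
  map_pi_eq_stdGaussian

instance : IsProbabilityMeasure (stdGaussianE n) := by
  rw [stdGaussianE_eq_stdGaussian]; infer_instance

variable (v : EuclideanSpace ℝ (Fin n))

lemma memLp_inner_stdGaussianE : MemLp (fun z => ⟪v, z⟫) 2 (stdGaussianE n) := by
  rw [stdGaussianE_eq_stdGaussian]
  exact IsGaussian.memLp_dual _ (innerSL ℝ v) 2 (by simp)

lemma integral_inner_stdGaussianE : ∫ z, ⟪v, z⟫ ∂(stdGaussianE n) = 0 := by
  rw [stdGaussianE_eq_stdGaussian]
  exact integral_strongDual_stdGaussian (innerSL ℝ v)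

lemma variance_inner_stdGaussianE : Var[fun z => ⟪v, z⟫; stdGaussianE n] = ‖v‖ ^ 2 := by
  rw [stdGaussianE_eq_stdGaussian]
  simpa using variance_dual_stdGaussian (innerSL ℝ v)

variable (m s : ℝ)

lemma memLp_affine_stdGaussianE : MemLp (fun z => m + s * ⟪v, z⟫) 2 (stdGaussianE n) :=
  (memLp_const m).add ((memLp_inner_stdGaussianE v).const_mul s)

lemma integral_affine_stdGaussianE : ∫ z, (m + s * ⟪v, z⟫) ∂(stdGaussianE n) = m := by
  rw [integral_add (integrable_const _)
    (((memLp_inner_stdGaussianE v).integrable one_le_two).const_mul s), integral_const_mul,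
    integral_inner_stdGaussianE]
  simp

lemma variance_affine_stdGaussianE :
    Var[fun z => m + s * ⟪v, z⟫; stdGaussianE n] = s ^ 2 * ‖v‖ ^ 2 := by
  rw [variance_const_add ((memLp_inner_stdGaussianE v).const_mul s).1, variance_const_mul,
    variance_inner_stdGaussianE]

lemma integral_sq_affine_stdGaussianE :
    ∫ z, (m + s * ⟪v, z⟫) ^ 2 ∂(stdGaussianE n) = m ^ 2 + s ^ 2 * ‖v‖ ^ 2 := by
  have h := variance_eq_sub (memLp_affine_stdGaussianE v m s)
  rw [variance_affine_stdGaussianE, integral_affine_stdGaussianE] at h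
  simp only [Pi.pow_apply] at h
  linarith

variable {v s} {A : Matrix (Fin n) (Fin n) ℝ} (μ : EuclideanSpace ℝ (Fin n))

lemma measurable_add_toEuclideanLin (μ : EuclideanSpace ℝ (Fin n))
    (A : Matrix (Fin n) (Fin n) ℝ) : Measurable fun x => μ + Matrix.toEuclideanLin A x :=
  (continuous_const.add (LinearMap.continuous_of_finiteDimensional _)).measurable

lemma inner_add_toEuclideanLin (hA : A.IsHermitian) (hv : Matrix.toEuclideanLin A v = s • v)
    (z : EuclideanSpace ℝ (Fin n)) :
    ⟪v, μ + Matrix.toEuclideanLin A z⟫ = ⟪v, μ⟫ + s * ⟪v, z⟫ := by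
  rw [inner_add_right, ← Matrix.isSymmetric_toEuclideanLin_iff.2 hA, hv, real_inner_smul_left]

lemma memLp_inner_gaussianE (hA : A.IsHermitian) (hv : Matrix.toEuclideanLin A v = s • v) :
    MemLp (fun x => ⟪v, x⟫) 2 (gaussianE μ A) := by
  rw [gaussianE, memLp_map_measure_iff (by fun_prop)
    (measurable_add_toEuclideanLin μ A).aemeasurable]
  simpa only [Function.comp_def, inner_add_toEuclideanLin _ hA hv] using
    memLp_affine_stdGaussianE v _ s

lemma integral_inner_gaussianE (hA : A.IsHermitian) (hv : Matrix.toEuclideanLin A v = s • v) :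
    ∫ x, ⟪v, x⟫ ∂(gaussianE μ A) = ⟪v, μ⟫ := by
  rw [gaussianE, integral_map (measurable_add_toEuclideanLin μ A).aemeasurable (by fun_prop)]
  simpa only [inner_add_toEuclideanLin _ hA hv] using integral_affine_stdGaussianE v _ s

lemma variance_inner_gaussianE (hA : A.IsHermitian) (hv : Matrix.toEuclideanLin A v = s • v) :
    Var[fun x => ⟪v, x⟫; gaussianE μ A] = s ^ 2 * ‖v‖ ^ 2 := by
  rw [gaussianE, variance_map (by fun_prop) (measurable_add_toEuclideanLin μ A).aemeasurable]
  simpa only [Function.comp_def, inner_add_toEuclideanLin _ hA hv] using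
    variance_affine_stdGaussianE v _ s

end Gaussian

/-- for multivariate Gaussians `N(μ₁,Cov₁)`, `N(μ₂,Cov₂)` with commuting
positive semidefinite covariances (`Aᵢ` is the psd square root of `Σᵢ`, so the
covariances commute iff the square roots do),
`W₂² = ‖μ₁ − μ₂‖² + ‖Cov₁^{1/2} − Cov₂^{1/2}‖_F²`. -/
theorem stmt_11 {n : ℕ} (μ₁ μ₂ : EuclideanSpace ℝ (Fin n))
    (Cov₁ Cov₂ A₁ A₂ : Matrix (Fin n) (Fin n) ℝ)
    (hCov₁ : Cov₁.PosSemidef) (hCov₂ : Cov₂.PosSemidef)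
    (hA₁ : A₁.PosSemidef) (hA₂ : A₂.PosSemidef)
    (hA₁sq : A₁ * A₁ = Cov₁) (hA₂sq : A₂ * A₂ = Cov₂)
    (hcomm : Cov₁ * Cov₂ = Cov₂ * Cov₁) :
    W2sqE (gaussianE μ₁ A₁) (gaussianE μ₂ A₂) =
      ENNReal.ofReal (‖μ₁ - μ₂‖ ^ 2 + ∑ i, ∑ j, (A₁ i j - A₂ i j) ^ 2) := by
  obtain ⟨e, a, b, he⟩ := hA₁.exists_common_orthonormalBasis hA₂
    (by rw [hA₁sq, hA₂sq]; exact hcomm)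
  have hcost (x y : EuclideanSpace ℝ (Fin n)) :
      ‖x - y‖ ^ 2 = ∑ i, (⟪e i, x⟫ - ⟪e i, y⟫) ^ 2 := by
    simp_rw [← inner_sub_right, e.sum_sq_inner_right]
  have hfrob : ∑ i, ∑ j, (A₁ i j - A₂ i j) ^ 2 = ∑ i, (a i - b i) ^ 2 :=
    sum_sq_entries_eq_sum_sq_eigenvalues (hA₁.isHermitian.sub hA₂.isHermitian) e fun i => by
      rw [map_sub, LinearMap.sub_apply, (he i).1.2, (he i).2.2, sub_smul]
  rw [hfrob, hcost, ← Finset.sum_add_distrib]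
  have hnonneg {α : Type} {f : α → Fin n → ℝ} (x : α) : 0 ≤ ∑ i, f x i ^ 2 :=
    Finset.sum_nonneg fun i _ => sq_nonneg _
  apply le_antisymm
  · set T := fun z => (μ₁ + Matrix.toEuclideanLin A₁ z, μ₂ + Matrix.toEuclideanLin A₂ z)
    have hT : Measurable T :=
      (measurable_add_toEuclideanLin μ₁ A₁).prodMk (measurable_add_toEuclideanLin μ₂ A₂)
    have hfst : ((stdGaussianE n).map T).map Prod.fst = gaussianE μ₁ A₁ :=
      Measure.map_map measurable_fst hT
    have hsnd : ((stdGaussianE n).map T).map Prod.snd = gaussianE μ₂ A₂ :=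
      Measure.map_map measurable_snd hT
    refine (iInf_le_of_le ((stdGaussianE n).map T) <|
      iInf_le_of_le hfst <| iInf_le_of_le hsnd le_rfl).trans_eq ?_
    rw [lintegral_map (by fun_prop) hT]
    have hT_cost (z : EuclideanSpace ℝ (Fin n)) : ‖(T z).1 - (T z).2‖ ^ 2 =
        ∑ i, ((⟪e i, μ₁⟫ - ⟪e i, μ₂⟫) + (a i - b i) * ⟪e i, z⟫) ^ 2 := by
      rw [hcost]
      refine Finset.sum_congr rfl fun i _ => ?_
      rw [inner_add_toEuclideanLin _ hA₁.isHermitian (he i).1.2,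
        inner_add_toEuclideanLin _ hA₂.isHermitian (he i).2.2]
      ring
    have hInt (i : Fin n) := (memLp_affine_stdGaussianE (e i)
      (⟪e i, μ₁⟫ - ⟪e i, μ₂⟫) (a i - b i)).integrable_sq
    simp_rw [hT_cost]
    rw [← ofReal_integral_eq_lintegral_ofReal (integrable_finsetSum _ fun i _ => hInt i)
      (.of_forall hnonneg), integral_finsetSum _ fun i _ => hInt i]
    simp [integral_sq_affine_stdGaussianE]
  · refine le_iInf fun γ => le_iInf fun h₁ => le_iInf fun h₂ => ?_
    have : IsProbabilityMeasure γ := by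
      have : IsProbabilityMeasure (gaussianE μ₁ A₁) :=
        Measure.isProbabilityMeasure_map (measurable_add_toEuclideanLin μ₁ A₁).aemeasurable
      rw [← h₁] at this
      exact Measure.isProbabilityMeasure_of_map Prod.fst
    have hX (i : Fin n) : MemLp (fun p => ⟪e i, p.1⟫) 2 γ := by
      have h := memLp_inner_gaussianE μ₁ hA₁.isHermitian (he i).1.2
      rw [← h₁] at h
      exact h.comp_of_map measurable_fst.aemeasurable
    have hY (i : Fin n) : MemLp (fun p => ⟪e i, p.2⟫) 2 γ := by
      have h := memLp_inner_gaussianE μ₂ hA₂.isHermitian (he i).2.2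
      rw [← h₂] at h
      exact h.comp_of_map measurable_snd.aemeasurable
    have hInt (i : Fin n) := ((hX i).sub (hY i)).integrable_sq
    simp only [Pi.sub_apply] at hInt
    simp_rw [hcost]
    rw [← ofReal_integral_eq_lintegral_ofReal (integrable_finsetSum _ fun i _ => hInt i)
      (.of_forall hnonneg), integral_finsetSum _ fun i _ => hInt i]
    refine ENNReal.ofReal_le_ofReal (Finset.sum_le_sum fun i _ => ?_)
    have hmX := integral_inner_gaussianE μ₁ hA₁.isHermitian (he i).1.2
    have hmY := integral_inner_gaussianE μ₂ hA₂.isHermitian (he i).2.2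
    have hvX := variance_inner_gaussianE μ₁ hA₁.isHermitian (he i).1.2
    have hvY := variance_inner_gaussianE μ₂ hA₂.isHermitian (he i).2.2
    rw [← h₁, integral_map measurable_fst.aemeasurable (by fun_prop)] at hmX
    rw [← h₂, integral_map measurable_snd.aemeasurable (by fun_prop)] at hmY
    rw [← h₁, variance_map (by fun_prop) measurable_fst.aemeasurable, e.norm_eq_one, one_pow,
      mul_one] at hvX
    rw [← h₂, variance_map (by fun_prop) measurable_snd.aemeasurable, e.norm_eq_one, one_pow,
      mul_one] at hvY
    rw [← hmX, ← hmY]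
    exact sq_sub_add_sq_sub_le_integral_sq_sub (hX i) (hY i) (he i).1.1 (he i).2.1 hvX hvY
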